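/- Let d, N be positive integers, m > 0, μ > 0, and let c : ℝ^d × ℝ^N → ℝ be a real-valued symbol of type (1,0) and order m with |c(x,ξ)| ≥ μ^{-1}·⟨ξ⟩^m whenever ‖ξ‖ ≥ μ. For t ∈ ℝ with |t| ≥ 1 let g_t := (c + i·t)^{-1} (pointwise reciprocal, which is defined since |c(x,ξ) + i·t| ≥ 1). Then: (i) for all j, l ∈ ℕ there is a constant C(j,l) such that ‖(D_x^j D_ξ^l g_t)(x,ξ)‖ ≤ C(j,l)·⟨ξ⟩^{−m−l} for all (x,ξ) and all |t| ≥ 1; (ii) for every ε > 0 and all j, l ∈ ℕ, sup over (x,ξ) of ⟨ξ⟩^{m−ε+l}·‖(D_x^j D_ξ^l g_t)(x,ξ)‖ tends to 0 as |t| → ∞. -/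

import Mathlib

/-- `⟨ξ⟩ := (1 + ‖ξ‖²)^{1/2}`. -/
noncomputable def jap {N : ℕ} (ξ : EuclideanSpace ℝ (Fin N)) : ℝ :=
  (1 + ‖ξ‖ ^ 2) ^ ((1 : ℝ) / 2)

/-- `a : ℝ^d × ℝ^N → F` is a symbol of type `(1,0)` and order `m`:
it is smooth, and for all `j, l` the iterated derivative of order `j` in `x`
and order `l` in `ξ` is bounded by `C(j,l) ⟨ξ⟩^{m-l}`. -/
def IsSymbol (d N : ℕ) (m : ℝ) {F : Type*} [NormedAddCommGroup F] [NormedSpace ℝ F]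
    (a : EuclideanSpace ℝ (Fin d) → EuclideanSpace ℝ (Fin N) → F) : Prop :=
  ContDiff ℝ (⊤ : ℕ∞)
      (fun p : EuclideanSpace ℝ (Fin d) × EuclideanSpace ℝ (Fin N) => a p.1 p.2) ∧
    ∀ j l : ℕ, ∃ C : ℝ, ∀ (x : EuclideanSpace ℝ (Fin d)) (ξ : EuclideanSpace ℝ (Fin N)),
      ‖iteratedFDeriv ℝ j (fun x' => iteratedFDeriv ℝ l (fun ξ' => a x' ξ') ξ) x‖ ≤
        C * jap ξ ^ (m - l)


section helpers
set_option linter.unusedSectionVars false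
open scoped ContDiff

variable {E F : Type*} [NormedAddCommGroup E] [NormedSpace ℝ E]
  [NormedAddCommGroup F] [NormedSpace ℝ F]
  {V : Type*} [NormedAddCommGroup V] [NormedSpace ℝ V]

/-- iterated directional derivative -/
noncomputable def dirD {P V : Type*} [NormedAddCommGroup P] [NormedSpace ℝ P]
    [NormedAddCommGroup V] [NormedSpace ℝ V] : List P → (P → V) → P → V
  | [], f => f
  | v :: L, f => fun p => fderiv ℝ (dirD L f) p v

theorem dirD_contDiff {P V : Type*} [NormedAddCommGroup P] [NormedSpace ℝ P]
    [NormedAddCommGroup V] [NormedSpace ℝ V] (L : List P) (f : P → V) (hf : ContDiff ℝ ∞ f) :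
    ContDiff ℝ ∞ (dirD L f) := by
  induction L with
  | nil => exact hf
  | cons v L ih =>
    have h := ih.fderiv_right (m := ∞) (by simp)
    exact h.clm_apply contDiff_const

/-- splits of a list with nonempty second part -/
def splits' {P : Type*} : List P → List (List P × List P)
  | [] => []
  | v :: L => (splits' L).map (fun q => (v :: q.1, q.2)) ++
      ((splits' L).map (fun q => (q.1, v :: q.2)) ++ [(L, [v])])

theorem splits'_length {P : Type*} (L : List P) : (splits' L).length ≤ 2 ^ L.length := by
  suffices h : (splits' L).length + 1 ≤ 2 ^ L.length by omega
  induction L with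
  | nil => simp [splits']
  | cons v L ih => simp [splits', pow_succ]; omega

theorem hasFDerivAt_list_sum {P V α : Type*} [NormedAddCommGroup P] [NormedSpace ℝ P]
    [NormedAddCommGroup V] [NormedSpace ℝ V] (S : List α) (G : α → P → V)
    (hG : ∀ a, Differentiable ℝ (G a)) (p : P) :
    HasFDerivAt (fun p => (S.map (fun a => G a p)).sum)
      (S.map (fun a => fderiv ℝ (G a) p)).sum p := by
  induction S with
  | nil => simpa using hasFDerivAt_const (0:V) p
  | cons a S ih =>
    simp only [List.map_cons, List.sum_cons]
    exact (hG a p).hasFDerivAt.add ih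

theorem list_sum_apply {P α : Type*} [NormedAddCommGroup P] [NormedSpace ℝ P]
    (S : List α) (G : α → P →L[ℝ] ℂ) (v : P) :
    (S.map G).sum v = (S.map (fun a => G a v)).sum := by
  induction S with
  | nil => simp
  | cons a S ih => simp [ih]

theorem dirD_mul {P : Type*} [NormedAddCommGroup P] [NormedSpace ℝ P]
    (f h : P → ℂ) (hf : ContDiff ℝ ∞ f) (hh : ContDiff ℝ ∞ h) (L : List P) :
    dirD L (fun p => f p * h p) = fun p => dirD L f p * h p +
      ((splits' L).map (fun q => dirD q.1 f p * dirD q.2 h p)).sum := by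
  induction L with
  | nil => simp [dirD, splits']
  | cons v L ih =>
    funext p
    have dif : ∀ (L : List P), Differentiable ℝ (dirD L f) := fun L =>
      (dirD_contDiff L f hf).differentiable (by simp)
    have dih : ∀ (L : List P), Differentiable ℝ (dirD L h) := fun L =>
      (dirD_contDiff L h hh).differentiable (by simp)
    have dhh : Differentiable ℝ h := dih []
    have h1 : HasFDerivAt (fun p => dirD L f p * h p) _ p :=
      (dif L p).hasFDerivAt.mul (dhh p).hasFDerivAt
    have h2 := hasFDerivAt_list_sum (splits' L) (fun q p => dirD q.1 f p * dirD q.2 h p)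
      (fun q => (dif q.1).mul (dih q.2)) p
    have h3 := (h1.add h2).fderiv
    have h4 : ∀ q : List P × List P, fderiv ℝ (fun p => dirD q.1 f p * dirD q.2 h p) p v
        = dirD (v :: q.1) f p * dirD q.2 h p + dirD q.1 f p * dirD (v :: q.2) h p := by
      intro q
      have : HasFDerivAt (fun p => dirD q.1 f p * dirD q.2 h p) _ p :=
        (dif q.1 p).hasFDerivAt.mul (dih q.2 p).hasFDerivAt
      rw [this.fderiv]
      simp [dirD]
      ring
    have h5 : dirD (v :: L) (fun p => f p * h p) p =
      fderiv ℝ (dirD L (fun p => f p * h p)) p v := rfl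
    rw [h5, ih]
    have h6 := congrArg (fun (T : P →L[ℝ] ℂ) => T v) h3
    refine Eq.trans h6 ?_
    rw [add_apply, list_sum_apply]
    simp only [h4, List.sum_map_add, splits', List.map_append, List.sum_append, List.map_map,
      Function.comp_def]
    simp [dirD]
    ring

inductive Adm (E F : Type*) [NormedAddCommGroup E] [NormedAddCommGroup F] :
    List (E × F) → ℕ → ℕ → ℝ → Prop
  | nil : Adm E F [] 0 0 1
  | consr (w : F) {L l r} (h : Adm E F L 0 l r) : Adm E F ((0, w) :: L) 0 (l + 1) (‖w‖ * r)
  | consl (v : E) {L j l r} (h : Adm E F L j l r) : Adm E F ((v, 0) :: L) (j + 1) l (‖v‖ * r)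

theorem Adm.nonneg {L : List (E × F)} {j l r} (h : Adm E F L j l r) : 0 ≤ r := by
  induction h <;> positivity

theorem Adm.length {L : List (E × F)} {j l r} (h : Adm E F L j l r) : L.length = j + l := by
  induction h with
  | nil => rfl
  | consr w h ih => simp [ih]
  | consl w h ih => simp [ih]; omega

theorem Adm.split {L : List (E × F)} {j l r} (h : Adm E F L j l r) :
    ∀ q ∈ splits' L, ∃ j1 l1 r1 j2 l2 r2, Adm E F q.1 j1 l1 r1 ∧ Adm E F q.2 j2 l2 r2 ∧
      j1 + j2 = j ∧ l1 + l2 = l ∧ r1 * r2 = r ∧ 0 < j2 + l2 := by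
  induction h with
  | nil => simp [splits']
  | consr w h ih =>
    intro q hq
    simp only [splits', List.mem_append, List.mem_map, List.mem_singleton] at hq
    rcases hq with ⟨q, hq, rfl⟩ | ⟨q, hq, rfl⟩ | rfl
    · obtain ⟨j1, l1, r1, j2, l2, r2, h1, h2, h3, h4, h5, h6⟩ := ih q hq
      obtain rfl : j1 = 0 := by omega
      exact ⟨_, _, _, _, _, _, .consr w h1, h2, h3, by omega, by rw [← h5]; ring, h6⟩
    · obtain ⟨j1, l1, r1, j2, l2, r2, h1, h2, h3, h4, h5, h6⟩ := ih q hq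
      obtain rfl : j2 = 0 := by omega
      exact ⟨_, _, _, _, _, _, h1, .consr w h2, h3, by omega, by rw [← h5]; ring, by omega⟩
    · exact ⟨_, _, _, _, _, _, h, .consr w .nil, by omega, by omega, by ring, by omega⟩
  | consl w h ih =>
    intro q hq
    simp only [splits', List.mem_append, List.mem_map, List.mem_singleton] at hq
    rcases hq with ⟨q, hq, rfl⟩ | ⟨q, hq, rfl⟩ | rfl
    · obtain ⟨j1, l1, r1, j2, l2, r2, h1, h2, h3, h4, h5, h6⟩ := ih q hq
      exact ⟨_, _, _, _, _, _, .consl w h1, h2, by omega, by omega, by rw [← h5]; ring, h6⟩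
    · obtain ⟨j1, l1, r1, j2, l2, r2, h1, h2, h3, h4, h5, h6⟩ := ih q hq
      exact ⟨_, _, _, _, _, _, h1, .consl w h2, by omega, by omega, by rw [← h5]; ring, by omega⟩
    · exact ⟨_, _, _, _, _, _, h, .consl w .nil, by omega, by omega, by ring, by omega⟩

/-- list attached to two families of directions -/
def LL {j l : ℕ} (v : Fin j → E) (w : Fin l → F) : List (E × F) :=
  List.ofFn (fun i => (v i, (0 : F))) ++ List.ofFn (fun i => ((0 : E), w i))

theorem LL_adm {j l : ℕ} (v : Fin j → E) (w : Fin l → F) :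
    Adm E F (LL v w) j l ((∏ i, ‖v i‖) * ∏ i, ‖w i‖) := by
  induction j with
  | zero =>
    induction l with
    | zero => simpa [LL] using Adm.nil
    | succ l ih =>
      have := Adm.consr (w 0) (ih (Fin.tail w))
      simpa [LL, Fin.prod_univ_succ, Fin.tail] using this
  | succ j ih =>
    have := Adm.consl (v 0) (ih (Fin.tail v))
    simpa [LL, Fin.prod_univ_succ, Fin.tail, mul_assoc] using this

theorem Adm.exists_LL {L : List (E × F)} {j l r} (h : Adm E F L j l r) :
    ∃ (v : Fin j → E) (w : Fin l → F), L = LL v w ∧ r = (∏ i, ‖v i‖) * ∏ i, ‖w i‖ := by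
  induction h with
  | nil => exact ⟨Fin.elim0, Fin.elim0, by simp [LL], by simp⟩
  | consr w h ih =>
    obtain ⟨v', w', rfl, rfl⟩ := ih
    exact ⟨v', Fin.cons w w', by simp [LL], by simp [Fin.prod_univ_succ]⟩
  | consl w h ih =>
    obtain ⟨v', w', rfl, rfl⟩ := ih
    exact ⟨Fin.cons w v', w', by simp [LL], by simp [Fin.prod_univ_succ, mul_assoc]⟩

theorem contDiff_iter (f : E → F → V) (hf : ContDiff ℝ ∞ (fun p : E × F => f p.1 p.2)) (l : ℕ) :
    ContDiff ℝ ∞ (fun p : E × F => iteratedFDeriv ℝ l (f p.1) p.2) := by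
  induction l with
  | zero =>
    simp only [iteratedFDeriv_zero_eq_comp, Function.comp_def]
    exact (continuousMultilinearCurryFin0 ℝ F V).symm.contDiff.comp hf
  | succ l ih =>
    simp only [iteratedFDeriv_succ_eq_comp_left, Function.comp_def]
    have hcur : ContDiff ℝ ∞
        ((continuousMultilinearCurryLeftEquiv ℝ (fun _ : Fin (l + 1) => F) V).symm) :=
      LinearIsometryEquiv.contDiff (E := F →L[ℝ] (F [×l]→L[ℝ] V)) (F := F [×(l + 1)]→L[ℝ] V) _
    refine hcur.comp ?_
    have h1 : ContDiff ℝ ∞ (Function.uncurry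
        (fun (p : E × F) (y : F) => iteratedFDeriv ℝ l (f p.1) y)) := by
      exact ih.comp (by fun_prop : ContDiff ℝ ∞ (fun q : (E × F) × F => (q.1.1, q.2)))
    exact h1.fderiv contDiff_snd (by simp)

theorem fderiv_right' (G : E × F → V) (hG : Differentiable ℝ G) (x : E) (ξ w : F) :
    fderiv ℝ (fun y => G (x, y)) ξ w = fderiv ℝ G (x, ξ) (0, w) := by
  have h : HasFDerivAt (fun y => G (x, y)) _ ξ :=
    (hG (x, ξ)).hasFDerivAt.comp ξ (hasFDerivAt_prodMk_right x ξ)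
  rw [h.fderiv]; simp

theorem fderiv_left' (G : E × F → V) (hG : Differentiable ℝ G) (x v : E) (ξ : F) :
    fderiv ℝ (fun y => G (y, ξ)) x v = fderiv ℝ G (x, ξ) (v, 0) := by
  have h : HasFDerivAt (fun y => G (y, ξ)) _ x :=
    (hG (x, ξ)).hasFDerivAt.comp x (hasFDerivAt_prodMk_left x ξ)
  rw [h.fderiv]; simp

theorem iter_succ_apply (f : F → V) (hf : ContDiff ℝ ∞ f) (n : ℕ) (x : F) (w : Fin (n+1) → F) :
    iteratedFDeriv ℝ (n+1) f x w =
      fderiv ℝ (fun y => iteratedFDeriv ℝ n f y (Fin.tail w)) x (w 0) := by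
  rw [iteratedFDeriv_succ_apply_left]
  have h : DifferentiableAt ℝ (iteratedFDeriv ℝ n f) x :=
    (hf.differentiable_iteratedFDeriv (by exact_mod_cast WithTop.coe_lt_top _)) x
  have := ((ContinuousMultilinearMap.apply ℝ (fun _ : Fin n => F) V (Fin.tail w)).hasFDerivAt.comp
    x h.hasFDerivAt).fderiv
  have h2 := congrArg (fun T : F →L[ℝ] V => T (w 0)) this
  exact h2.symm

theorem bridge (f : E → F → V) (hf : ContDiff ℝ ∞ (fun p : E × F => f p.1 p.2)) {j l : ℕ}
    (v : Fin j → E) (w : Fin l → F) (x : E) (ξ : F) :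
    iteratedFDeriv ℝ j (fun x' => iteratedFDeriv ℝ l (fun ξ' => f x' ξ') ξ) x v w =
      dirD (LL v w) (fun p : E × F => f p.1 p.2) (x, ξ) := by
  induction j generalizing x ξ with
  | zero =>
    rw [iteratedFDeriv_zero_apply]
    induction l generalizing x ξ with
    | zero => simp [LL, dirD]
    | succ l ih =>
      have hx : ContDiff ℝ ∞ (fun ξ' => f x ξ') :=
        hf.comp (by fun_prop : ContDiff ℝ ∞ (fun y : F => (x, y)))
      rw [iter_succ_apply _ hx]
      have e : LL v w = (0, w 0) :: LL v (Fin.tail w) := by simp [LL, Fin.tail]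
      rw [e]
      simp only [ih, dirD]
      exact fderiv_right' _ ((dirD_contDiff _ _ hf).differentiable (by simp)) _ _ _
  | succ j ih =>
    have hs : ContDiff ℝ ∞ (fun x' => iteratedFDeriv ℝ l (fun ξ' => f x' ξ') ξ) :=
      (contDiff_iter f hf l).comp (by fun_prop : ContDiff ℝ ∞ (fun y : E => (y, ξ)))
    rw [iter_succ_apply _ hs]
    have e : LL v w = (v 0, 0) :: LL (Fin.tail v) w := by simp [LL, Fin.tail]
    rw [e]
    simp only [dirD]
    rw [← fderiv_left' _ ((dirD_contDiff _ _ hf).differentiable (by simp))]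
    simp only [← ih]
    have h : DifferentiableAt ℝ (fun y => iteratedFDeriv ℝ j
        (fun x' => iteratedFDeriv ℝ l (fun ξ' => f x' ξ') ξ) y (Fin.tail v)) x := by
      have h : DifferentiableAt ℝ (iteratedFDeriv ℝ j
        (fun x' => iteratedFDeriv ℝ l (fun ξ' => f x' ξ') ξ)) x :=
        (hs.differentiable_iteratedFDeriv (by exact_mod_cast WithTop.coe_lt_top _)) x
      exact ((ContinuousMultilinearMap.apply ℝ (fun _ : Fin j => E) _
        (Fin.tail v)).differentiableAt.comp x h)
    have := ((ContinuousMultilinearMap.apply ℝ (fun _ : Fin l => F) V w).hasFDerivAt.comp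
      x h.hasFDerivAt).fderiv
    exact (congrArg (fun T : E →L[ℝ] V => T (v 0)) this).symm

theorem dirD_ofReal {P : Type*} [NormedAddCommGroup P] [NormedSpace ℝ P]
    (f : P → ℝ) (hf : ContDiff ℝ ∞ f) (z : ℂ) (L : List P) (hL : L ≠ []) :
    dirD L (fun p => (f p : ℂ) + z) = fun p => ((dirD L f p : ℝ) : ℂ) := by
  have key : ∀ (G : P → ℝ) (hG : Differentiable ℝ G) (z : ℂ) (p v : P),
      fderiv ℝ (fun p => (G p : ℂ) + z) p v = ((fderiv ℝ G p v : ℝ) : ℂ) := by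
    intro G hG z p v
    have h : HasFDerivAt (fun p => (G p : ℂ) + z) _ p :=
      (Complex.ofRealCLM.hasFDerivAt.comp p (hG p).hasFDerivAt).add_const z
    rw [h.fderiv]; simp
  induction L with
  | nil => exact absurd rfl hL
  | cons v L ih =>
    funext p
    have d := (dirD_contDiff L f hf).differentiable (by simp)
    by_cases h : L = []
    · subst h; exact key _ d _ _ _
    · simp only [dirD, ih h]
      simpa using key _ d 0 p v
end helpers

theorem one_le_jap {N : ℕ} (ξ : EuclideanSpace ℝ (Fin N)) : 1 ≤ jap ξ :=
  Real.one_le_rpow (by nlinarith [sq_nonneg ‖ξ‖]) (by norm_num)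

theorem list_sum_norm_le {α : Type*} (S : List α) (G : α → ℂ) (M : ℝ)
    (h : ∀ a ∈ S, ‖G a‖ ≤ M) : ‖(S.map G).sum‖ ≤ S.length * M := by
  induction S with
  | nil => simp
  | cons a S ih =>
    have h1 := h a (by simp)
    have h2 := ih (fun b hb => h b (by simp [hb]))
    simp only [List.map_cons, List.sum_cons, List.length_cons]
    push_cast
    linarith [norm_add_le (G a) (S.map G).sum]

/-- the resolvent -/
noncomputable def gg {d N : ℕ} (c : EuclideanSpace ℝ (Fin d) → EuclideanSpace ℝ (Fin N) → ℝ)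
    (t : ℝ) (p : EuclideanSpace ℝ (Fin d) × EuclideanSpace ℝ (Fin N)) : ℂ :=
  (((c p.1 p.2 : ℝ) : ℂ) + t * Complex.I)⁻¹

section main
open scoped ContDiff

variable {d N : ℕ} {m μ : ℝ} {c : EuclideanSpace ℝ (Fin d) → EuclideanSpace ℝ (Fin N) → ℝ}

theorem abs_t_le (a t : ℝ) : |t| ≤ ‖(a : ℂ) + t * Complex.I‖ := by
  simpa using Complex.abs_im_le_norm ((a : ℂ) + t * Complex.I)

theorem abs_c_le (a t : ℝ) : |a| ≤ ‖(a : ℂ) + t * Complex.I‖ := by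
  simpa using Complex.abs_re_le_norm ((a : ℂ) + t * Complex.I)

theorem h_ne (a t : ℝ) (ht : 1 ≤ |t|) : (a : ℂ) + t * Complex.I ≠ 0 := by
  have := abs_t_le a t
  exact norm_pos_iff.1 (by linarith)

theorem gg_le_t (t : ℝ) (ht : 1 ≤ |t|) (p) : ‖gg c t p‖ ≤ |t|⁻¹ := by
  rw [gg, norm_inv]
  exact inv_anti₀ (by linarith) (abs_t_le _ _)

theorem gg_bound (hm : 0 < m) (hμ : 0 < μ)
    (hell : ∀ x ξ, μ ≤ ‖ξ‖ → μ⁻¹ * jap ξ ^ m ≤ |c x ξ|) :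
    ∃ K : ℝ, 0 < K ∧ ∀ t : ℝ, 1 ≤ |t| → ∀ x ξ, ‖gg c t (x, ξ)‖ * jap ξ ^ m ≤ K := by
  refine ⟨max μ (((1 + μ ^ 2) ^ ((1 : ℝ) / 2)) ^ m), lt_max_of_lt_left hμ, ?_⟩
  intro t ht x ξ
  have hJ := one_le_jap ξ
  have hJm : 0 < jap ξ ^ m := Real.rpow_pos_of_pos (by linarith) _
  rcases le_or_gt μ ‖ξ‖ with h | h
  · refine le_max_of_le_left ?_
    have h1 := (hell x ξ h).trans (abs_c_le (c x ξ) t)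
    have h2 : ‖gg c t (x, ξ)‖ ≤ (μ⁻¹ * jap ξ ^ m)⁻¹ := by
      rw [gg, norm_inv]
      exact inv_anti₀ (by positivity) h1
    calc _ ≤ (μ⁻¹ * jap ξ ^ m)⁻¹ * jap ξ ^ m := by gcongr
      _ = μ := by field_simp
  · refine le_max_of_le_right ?_
    have h1 : ‖gg c t (x, ξ)‖ ≤ 1 := (gg_le_t t ht _).trans (inv_le_one_of_one_le₀ ht)
    have h2 : jap ξ ^ m ≤ ((1 + μ ^ 2) ^ ((1 : ℝ) / 2)) ^ m := by
      unfold jap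
      gcongr
    calc _ ≤ 1 * jap ξ ^ m := by gcongr
      _ ≤ _ := by rw [one_mul]; exact h2

theorem gg_contDiff (hc : IsSymbol d N m c) (t : ℝ) (ht : 1 ≤ |t|) : ContDiff ℝ ∞ (gg c t) := by
  have h1 : ContDiff ℝ ∞ (fun p : EuclideanSpace ℝ (Fin d) × EuclideanSpace ℝ (Fin N) =>
      ((c p.1 p.2 : ℝ) : ℂ) + t * Complex.I) :=
    (Complex.ofRealCLM.contDiff.comp hc.1).add contDiff_const
  exact h1.inv (fun p => h_ne _ _ ht)

theorem c_bound (hc : IsSymbol d N m c) (n : ℕ) : ∃ A : ℝ, 0 ≤ A ∧ ∀ L j l r,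
    Adm (EuclideanSpace ℝ (Fin d)) (EuclideanSpace ℝ (Fin N)) L j l r → j + l ≤ n → ∀ x ξ,
    ‖dirD L (fun p => c p.1 p.2) (x, ξ)‖ ≤ A * jap ξ ^ (m - l) * r := by
  choose C hC using hc.2
  refine ⟨∑ j ∈ Finset.range (n + 1), ∑ l ∈ Finset.range (n + 1), |C j l|, by positivity, ?_⟩
  intro L j l r hL hjl x ξ
  have hr := hL.nonneg
  obtain ⟨v, w, rfl, rfl⟩ := hL.exists_LL
  rw [← bridge c hc.1]
  have hJ : 0 < jap ξ := by linarith [one_le_jap ξ]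
  have h1 : |C j l| ≤ ∑ j ∈ Finset.range (n + 1), ∑ l ∈ Finset.range (n + 1), |C j l| := by
    refine le_trans ?_ (Finset.single_le_sum (f := fun j => ∑ l ∈ Finset.range (n + 1), |C j l|)
      (fun _ _ => by positivity) (Finset.mem_range.2 (by omega : j < n + 1)))
    exact Finset.single_le_sum (f := fun l => |C j l|)
      (fun _ _ => by positivity) (Finset.mem_range.2 (by omega : l < n + 1))
  set T := iteratedFDeriv ℝ j (fun x' => iteratedFDeriv ℝ l (fun ξ' => c x' ξ') ξ) x
  calc ‖T v w‖ ≤ ‖T v‖ * ∏ i, ‖w i‖ := (T v).le_opNorm w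
    _ ≤ (‖T‖ * ∏ i, ‖v i‖) * ∏ i, ‖w i‖ := by gcongr; exact T.le_opNorm v
    _ = ‖T‖ * ((∏ i, ‖v i‖) * ∏ i, ‖w i‖) := by ring
    _ ≤ _ := by
      refine mul_le_mul_of_nonneg_right ?_ hr
      refine (hC j l x ξ).trans ?_
      refine mul_le_mul_of_nonneg_right ?_ (by positivity)
      exact (le_abs_self _).trans h1

theorem dirD_const_one {P : Type*} [NormedAddCommGroup P] [NormedSpace ℝ P] (L : List P)
    (hL : L ≠ []) : dirD L (fun _ => (1 : ℂ)) = fun _ => 0 := by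
  induction L with
  | nil => exact absurd rfl hL
  | cons v L ih =>
    by_cases h : L = []
    · subst h; funext p; simp [dirD]
    · funext p; simp [dirD, ih h]

theorem core (hm : 0 < m) (hμ : 0 < μ) (hc : IsSymbol d N m c)
    (hell : ∀ x ξ, μ ≤ ‖ξ‖ → μ⁻¹ * jap ξ ^ m ≤ |c x ξ|) (n : ℕ) :
    ∃ B : ℝ, 0 ≤ B ∧ ∀ t : ℝ, 1 ≤ |t| → ∀ L j l r,
    Adm (EuclideanSpace ℝ (Fin d)) (EuclideanSpace ℝ (Fin N)) L j l r → j + l ≤ n → ∀ x ξ,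
    ‖dirD L (gg c t) (x, ξ)‖ ≤ B * ‖gg c t (x, ξ)‖ * jap ξ ^ (-(l : ℝ)) * r := by
  obtain ⟨K, hK, hgK⟩ := gg_bound hm hμ hell
  induction n with
  | zero =>
    refine ⟨1, zero_le_one, ?_⟩
    intro t ht L j l r hL hjl x ξ
    cases hL with
    | nil => simp [dirD]
    | consr => omega
    | consl => omega
  | succ n ih =>
    obtain ⟨B, hB, ihB⟩ := ih
    obtain ⟨A, hA, hcA⟩ := c_bound hc (n + 1)
    refine ⟨max B (2 ^ (n + 1) * (A * B * K)), le_max_of_le_left hB, ?_⟩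
    intro t ht L j l r hL hjl x ξ
    have hJ : 0 < jap ξ := by linarith [one_le_jap ξ]
    have hr := hL.nonneg
    rcases Nat.lt_or_ge n (j + l) with hn | hn
    swap
    · refine (ihB t ht L j l r hL hn x ξ).trans ?_
      gcongr
      exact le_max_left _ _
    have hlen : L.length = n + 1 := by rw [hL.length]; omega
    have hLne : L ≠ [] := by intro h; simp [h] at hlen
    let h : EuclideanSpace ℝ (Fin d) × EuclideanSpace ℝ (Fin N) → ℂ :=
      fun p => ((c p.1 p.2 : ℝ) : ℂ) + t * Complex.I
    have hh : ContDiff ℝ ∞ h :=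
      (Complex.ofRealCLM.contDiff.comp hc.1).add contDiff_const
    have hne : ∀ p, h p ≠ 0 := fun p => h_ne _ _ ht
    have hone : (fun p => gg c t p * h p) = fun _ => 1 := by
      funext p; exact inv_mul_cancel₀ (hne p)
    have hmul := congrFun (dirD_mul (gg c t) h (gg_contDiff hc t ht) hh L) (x, ξ)
    rw [hone, dirD_const_one L hLne] at hmul
    set S := ((splits' L).map (fun q => dirD q.1 (gg c t) (x, ξ) * dirD q.2 h (x, ξ))).sum with hS
    have hSb : ‖S‖ ≤ (splits' L).length * (A * B * K * jap ξ ^ (-(l : ℝ)) * r) := by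
      refine list_sum_norm_le _ _ _ ?_
      intro q hq
      obtain ⟨j1, l1, r1, j2, l2, r2, a1, a2, ej, el, er, hpos⟩ := hL.split q hq
      have hq2 : q.2 ≠ [] := by
        intro h; have := a2.length; rw [h] at this; simp at this; omega
      have b1 := ihB t ht q.1 j1 l1 r1 a1 (by omega) x ξ
      have b2 : ‖dirD q.2 h (x, ξ)‖ ≤ A * jap ξ ^ (m - l2) * r2 := by
        have := hcA q.2 j2 l2 r2 a2 (by omega) x ξ
        rw [dirD_ofReal _ hc.1 _ _ hq2]
        simpa using this
      have hr1 := a1.nonneg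
      have hr2 := a2.nonneg
      have hpow : jap ξ ^ (-(l1 : ℝ)) * jap ξ ^ (m - l2) = jap ξ ^ m * jap ξ ^ (-(l : ℝ)) := by
        rw [← Real.rpow_add hJ, ← Real.rpow_add hJ]
        congr 1
        rw [← el]; push_cast; ring
      rw [norm_mul]
      calc _ ≤ (B * ‖gg c t (x, ξ)‖ * jap ξ ^ (-(l1 : ℝ)) * r1) * (A * jap ξ ^ (m - l2) * r2) := by
            gcongr
        _ = A * B * ‖gg c t (x, ξ)‖ * (jap ξ ^ (-(l1 : ℝ)) * jap ξ ^ (m - l2)) * (r1 * r2) := by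
            ring
        _ = A * B * (‖gg c t (x, ξ)‖ * jap ξ ^ m) * jap ξ ^ (-(l : ℝ)) * r := by
            rw [hpow, er]; ring
        _ ≤ _ := by gcongr; exact hgK t ht x ξ
    have hD : dirD L (gg c t) (x, ξ) = -(S * gg c t (x, ξ)) := by
      have e : dirD L (gg c t) (x, ξ) * h (x, ξ) = -S := by linear_combination -hmul
      have e2 : gg c t (x, ξ) = (h (x, ξ))⁻¹ := rfl
      have := hne (x, ξ)
      rw [e2]
      field_simp
      exact e
    have hlen2 : ((splits' L).length : ℝ) ≤ 2 ^ (n + 1) := by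
      have := splits'_length L
      rw [hlen] at this
      exact_mod_cast this
    rw [hD, norm_neg, norm_mul]
    calc _ ≤ (2 ^ (n + 1) * (A * B * K * jap ξ ^ (-(l : ℝ)) * r)) * ‖gg c t (x, ξ)‖ := by
          gcongr
          exact hSb.trans (by gcongr)
      _ = (2 ^ (n + 1) * (A * B * K)) * ‖gg c t (x, ξ)‖ * jap ξ ^ (-(l : ℝ)) * r := by ring
      _ ≤ _ := by gcongr; exact le_max_right _ _

theorem core2 (hm : 0 < m) (hμ : 0 < μ) (hc : IsSymbol d N m c)
    (hell : ∀ x ξ, μ ≤ ‖ξ‖ → μ⁻¹ * jap ξ ^ m ≤ |c x ξ|) (j l : ℕ) :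
    ∃ B : ℝ, 0 ≤ B ∧ ∀ t : ℝ, 1 ≤ |t| → ∀ x ξ,
    ‖iteratedFDeriv ℝ j (fun x' => iteratedFDeriv ℝ l
        (fun ξ' => (((c x' ξ' : ℝ) : ℂ) + t * Complex.I)⁻¹) ξ) x‖ ≤
      B * ‖gg c t (x, ξ)‖ * jap ξ ^ (-(l : ℝ)) := by
  obtain ⟨B, hB, h⟩ := core hm hμ hc hell (j + l)
  refine ⟨B, hB, ?_⟩
  intro t ht x ξ
  have hJ : 0 < jap ξ := by linarith [one_le_jap ξ]
  refine ContinuousMultilinearMap.opNorm_le_bound (by positivity) fun v => ?_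
  refine ContinuousMultilinearMap.opNorm_le_bound (by positivity) fun w => ?_
  rw [bridge (fun x' ξ' => (((c x' ξ' : ℝ) : ℂ) + t * Complex.I)⁻¹) (gg_contDiff hc t ht)]
  rw [mul_assoc (B * ‖gg c t (x, ξ)‖ * jap ξ ^ (-(l : ℝ)))]
  exact h t ht _ j l _ (LL_adm v w) le_rfl x ξ

end main

theorem statement5 (d N : ℕ) (hd : 0 < d) (hN : 0 < N) (m μ : ℝ) (hm : 0 < m)
    (hμ : 0 < μ)
    (c : EuclideanSpace ℝ (Fin d) → EuclideanSpace ℝ (Fin N) → ℝ)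
    (hc : IsSymbol d N m c)
    (hell : ∀ x ξ, μ ≤ ‖ξ‖ → μ⁻¹ * jap ξ ^ m ≤ |c x ξ|) :
    (∀ j l : ℕ, ∃ C : ℝ, ∀ t : ℝ, 1 ≤ |t| →
      ∀ (x : EuclideanSpace ℝ (Fin d)) (ξ : EuclideanSpace ℝ (Fin N)),
        ‖iteratedFDeriv ℝ j
            (fun x' => iteratedFDeriv ℝ l
              (fun ξ' => (((c x' ξ' : ℝ) : ℂ) + t * Complex.I)⁻¹) ξ) x‖ ≤
          C * jap ξ ^ (-m - l)) ∧
    (∀ ε : ℝ, 0 < ε → ∀ j l : ℕ, ∀ δ : ℝ, 0 < δ → ∃ T : ℝ, ∀ t : ℝ, T ≤ |t| →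
      ∀ (x : EuclideanSpace ℝ (Fin d)) (ξ : EuclideanSpace ℝ (Fin N)),
        jap ξ ^ (m - ε + l) *
            ‖iteratedFDeriv ℝ j
              (fun x' => iteratedFDeriv ℝ l
                (fun ξ' => (((c x' ξ' : ℝ) : ℂ) + t * Complex.I)⁻¹) ξ) x‖ ≤ δ) := by
  obtain ⟨K, hK, hgK⟩ := gg_bound hm hμ hell
  refine ⟨?_, ?_⟩
  · intro j l
    obtain ⟨B, hB, h⟩ := core2 hm hμ hc hell j l
    refine ⟨B * K, ?_⟩
    intro t ht x ξ
    have hJ : 0 < jap ξ := by linarith [one_le_jap ξ]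
    refine (h t ht x ξ).trans ?_
    have e : jap ξ ^ (-m - l) = jap ξ ^ (-m) * jap ξ ^ (-(l : ℝ)) := by
      rw [← Real.rpow_add hJ]; congr 1
    have e2 : ‖gg c t (x, ξ)‖ ≤ K * jap ξ ^ (-m) := by
      rw [Real.rpow_neg hJ.le, ← div_eq_mul_inv, le_div_iff₀ (by positivity)]
      exact hgK t ht x ξ
    calc _ ≤ B * (K * jap ξ ^ (-m)) * jap ξ ^ (-(l : ℝ)) := by gcongr
      _ = _ := by rw [e]; ring
  · intro ε hε j l δ hδ
    obtain ⟨B, hB, h⟩ := core2 hm hμ hc hell j l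
    -- interpolation exponent
    set θ := min (ε / m) 1 with hθ
    have hθ0 : 0 < θ := lt_min (by positivity) one_pos
    have hθ1 : θ ≤ 1 := min_le_right _ _
    have hθm : θ * m ≤ ε := by
      have : θ ≤ ε / m := min_le_left _ _
      rwa [le_div_iff₀ hm] at this
    have hlim : Filter.Tendsto (fun s : ℝ => B * K ^ (1 - θ) * s ^ (-θ)) Filter.atTop
        (nhds 0) := by
      simpa using (tendsto_rpow_neg_atTop hθ0).const_mul (B * K ^ (1 - θ))
    obtain ⟨T, hT⟩ := Filter.eventually_atTop.1 (hlim.eventually_lt_const hδ)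
    refine ⟨max T 1, ?_⟩
    intro t htT x ξ
    have ht : 1 ≤ |t| := (le_max_right _ _).trans htT
    have ht0 : 0 < |t| := by linarith
    have hJ1 := one_le_jap ξ
    have hJ : 0 < jap ξ := by linarith
    refine le_trans ?_ (hT |t| ((le_max_left _ _).trans htT)).le
    set G := ‖gg c t (x, ξ)‖ with hG
    have hG0 : 0 < G := norm_pos_iff.2 (inv_ne_zero (h_ne _ _ ht))
    have e1 : jap ξ ^ (m - ε + l) * (B * G * jap ξ ^ (-(l : ℝ))) = B * (jap ξ ^ (m - ε) * G) := by
      have : jap ξ ^ (m - ε) = jap ξ ^ (m - ε + l) * jap ξ ^ (-(l : ℝ)) := by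
        rw [← Real.rpow_add hJ]; congr 1; ring
      rw [this]; ring
    have e2 : jap ξ ^ (m - ε) ≤ (jap ξ ^ m) ^ (1 - θ) := by
      rw [← Real.rpow_mul hJ.le]
      exact Real.rpow_le_rpow_of_exponent_le hJ1 (by linarith)
    have e3 : G = G ^ (1 - θ) * G ^ θ := by
      rw [← Real.rpow_add hG0]; simp
    have e4 : G ^ θ ≤ |t| ^ (-θ) := by
      rw [Real.rpow_neg ht0.le, ← Real.inv_rpow ht0.le]
      exact Real.rpow_le_rpow hG0.le (gg_le_t t ht _) hθ0.le
    have e5 : (G * jap ξ ^ m) ^ (1 - θ) ≤ K ^ (1 - θ) :=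
      Real.rpow_le_rpow (by positivity) (hgK t ht x ξ) (by linarith)
    calc _ ≤ jap ξ ^ (m - ε + l) * (B * G * jap ξ ^ (-(l : ℝ))) := by
          gcongr; exact h t ht x ξ
      _ = B * (jap ξ ^ (m - ε) * G) := e1
      _ ≤ B * ((jap ξ ^ m) ^ (1 - θ) * G) := by gcongr
      _ = B * ((G * jap ξ ^ m) ^ (1 - θ) * G ^ θ) := by
          rw [Real.mul_rpow hG0.le (by positivity)]
          nth_rewrite 1 [e3]
          ring
      _ ≤ B * (K ^ (1 - θ) * |t| ^ (-θ)) := by gcongr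
      _ = _ := by ring
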